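/- Let H be the graph obtained from a cycle x_0 x_1 … x_17 x_0 of length 18 by adding two pendant vertices, one adjacent to x_8 and one adjacent to x_16. Then: (a) there is no (1,2,2)-packing coloring c of H with c(x_0) = c(x_6) = c(x_12) ∈ {2, 3}, i.e., x_0, x_6 and x_12 never all receive the same color from the two 2-packing classes; and (b) there exists a (1,2,2)-packing coloring of H with c(x_0) = c(x_12) = 2 and c(x_6) = 3. -/

import Mathlib

/-- `c` is an `s`-packing coloring of the simple graph `G`: for each color `i`, any two
distinct vertices with color `i` are at graph distance strictly greater than `s i`
(vertices in different connected components trivially satisfy this). -/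
def IsPackingColoring {V : Type*} (G : SimpleGraph V) {k : ℕ} (s : Fin k → ℕ)
    (c : V → Fin k) : Prop :=
  ∀ u v : V, u ≠ v → c u = c v → G.Reachable u v → s (c u) < G.dist u v

/-- The graph `H`: a cycle `x₀ x₁ … x₁₇ x₀` of length `18` (vertices `0,…,17`) with a
pendant vertex `18` adjacent to `x₈` and a pendant vertex `19` adjacent to `x₁₆`. -/
def graphH : SimpleGraph (Fin 20) :=
  SimpleGraph.fromRel (fun u v =>
    (u.val < 18 ∧ v.val = (u.val + 1) % 18) ∨
    (u = 8 ∧ v = 18) ∨ (u = 16 ∧ v = 19))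

instance : DecidableRel graphH.Adj := fun u v => by
  unfold graphH
  rw [SimpleGraph.fromRel_adj]
  infer_instance

/-- A coloring is a `(1,2,2)`-packing coloring iff it is proper and any two distinct
vertices with a common neighbor share at most the color `0`. -/
theorem isPackingColoring_one_two_two_iff {V : Type*} {G : SimpleGraph V} {c : V → Fin 3} :
    IsPackingColoring G ![1, 2, 2] c ↔
      (∀ u v, G.Adj u v → c u ≠ c v) ∧
        ∀ u w v, G.Adj u w → G.Adj w v → u ≠ v → c u = c v → c u = 0 := by
  constructor
  · refine fun h => ⟨fun u v huv hc => ?_, fun u w v huw hwv hne hc => ?_⟩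
    · have hlt := h u v huv.ne hc huv.reachable
      rw [SimpleGraph.dist_eq_one_iff_adj.mpr huv] at hlt
      generalize c u = i at hlt
      fin_cases i <;> simp at hlt
    · have hlt := h u v hne hc (huw.reachable.trans hwv.reachable)
      have hle := SimpleGraph.dist_le (.cons huw (.cons hwv .nil))
      simp only [SimpleGraph.Walk.length_cons, SimpleGraph.Walk.length_nil] at hle
      generalize c u = i at hlt
      fin_cases i <;> simp at hlt ⊢ <;> omega
  · rintro ⟨hadj, hcommon⟩ u v hne hc hr
    have hpos := hr.pos_dist_of_ne hne
    have hone : G.dist u v ≠ 1 := fun h =>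
      hadj u v (SimpleGraph.dist_eq_one_iff_adj.mp h) hc
    have htwo : G.dist u v = 2 → c u = 0 := by
      intro h
      obtain ⟨p, hp⟩ := hr.exists_walk_length_eq_dist
      rw [h] at hp
      match p, hp with
      | .cons huw (.cons hwv .nil), _ => exact hcommon _ _ _ huw hwv hne hc
    generalize c u = i at htwo
    fin_cases i <;> simp at htwo ⊢ <;> omega

/-- On a path `y₀ … y₆` whose ends share a color other than `0`, if `y₄` does not have
color `0` then neither does `y₁`. -/
theorem path_color_one_ne_zero {y : Fin 7 → Fin 3}
    (hadj : ∀ i : Fin 6, y i.castSucc ≠ y i.succ)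
    (hcommon : ∀ i : Fin 5, y i.castSucc.castSucc = y i.succ.succ → y i.castSucc.castSucc = 0)
    (hends : y 0 = y 6) (h₀ : y 0 ≠ 0) (h₄ : y 4 ≠ 0) : y 1 ≠ 0 := by
  simp [Fin.forall_fin_succ] at hadj hcommon
  generalize y 0 = y₀ at *
  grind

/-- In a `(1,2,2)`-packing coloring (colors `0, 1, 2` where `1` and `2` are the two
`2`-packing classes): (a) `x₀, x₆, x₁₂` never all receive the same color from `{1, 2}`;
(b) there is a coloring with `c x₀ = c x₁₂ = 1` and `c x₆ = 2`. -/
theorem graphH_clause_simulator :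
    (¬ ∃ c : Fin 20 → Fin 3, IsPackingColoring graphH ![1, 2, 2] c ∧
        c 0 = c 6 ∧ c 6 = c 12 ∧ (c 0 = 1 ∨ c 0 = 2)) ∧
    (∃ c : Fin 20 → Fin 3, IsPackingColoring graphH ![1, 2, 2] c ∧
        c 0 = 1 ∧ c 12 = 1 ∧ c 6 = 2) := by
  constructor
  · rintro ⟨c, hc, h₀₆, h₆₁₂, h₀⟩
    obtain ⟨hadj, hcommon⟩ := isPackingColoring_one_two_two_iff.mp hc
    have hne : c 0 ≠ 0 := by rcases h₀ with h | h <;> simp [h]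
    have h₈ : c 8 ≠ 0 := by
      have := hadj 8 7 (by decide)
      have := hadj 8 9 (by decide)
      have := hadj 8 18 (by decide)
      have := hcommon 7 8 9 (by decide) (by decide) (by decide)
      have := hcommon 7 8 18 (by decide) (by decide) (by decide)
      have := hcommon 9 8 18 (by decide) (by decide) (by decide)
      omega
    have h₁₆ : c 16 ≠ 0 := by
      have := hadj 16 15 (by decide)
      have := hadj 16 17 (by decide)
      have := hadj 16 19 (by decide)
      have := hcommon 15 16 17 (by decide) (by decide) (by decide)
      have := hcommon 15 16 19 (by decide) (by decide) (by decide)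
      have := hcommon 17 16 19 (by decide) (by decide) (by decide)
      omega
    have hpath (p : Fin 7 → Fin 20) (hp : ∀ i : Fin 6, graphH.Adj (p i.castSucc) (p i.succ))
        (hp' : ∀ i : Fin 5, p i.castSucc.castSucc ≠ p i.succ.succ)
        (hends : c (p 0) = c (p 6)) (hstart : c (p 0) ≠ 0) (hfour : c (p 4) ≠ 0) :
        c (p 1) ≠ 0 :=
      path_color_one_ne_zero (y := c ∘ p) (fun i => hadj _ _ (hp i))
        (fun i => hcommon _ _ _ (hp i.castSucc) (hp i.succ) (hp' i)) hends hstart hfour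
    have h₁₁ : c 11 ≠ 0 :=
      hpath ![12, 11, 10, 9, 8, 7, 6] (by decide) (by decide) h₆₁₂.symm
        (h₆₁₂ ▸ h₀₆ ▸ hne) h₈
    have h₁₃ : c 13 ≠ 0 :=
      hpath ![12, 13, 14, 15, 16, 17, 0] (by decide) (by decide) (h₀₆.trans h₆₁₂).symm
        (h₆₁₂ ▸ h₀₆ ▸ hne) h₁₆
    have := hadj 12 11 (by decide)
    have := hadj 12 13 (by decide)
    have := hcommon 11 12 13 (by decide) (by decide) (by decide)
    omega
  · refine ⟨![1, 0, 2, 0, 1, 0, 2, 0, 1, 0, 2, 0, 1, 2, 0, 1, 2, 0, 0, 0],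
      isPackingColoring_one_two_two_iff.mpr ⟨by decide, ?_⟩, rfl, rfl, rfl⟩
    decide
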